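/- arXiv:2605.31269 — 2 statements merged into one kernel-verified Lean document; each statement's English description precedes it below -/
import Mathlib

section
/- Every ∀D(τ)-formula φ(x₁,…,xₙ) is ω-coherent: for every τ-structure A and every team T with domain {x₁,…,xₙ}, A ⊨_T φ if and only if A ⊨_S φ for every finite subteam S ⊆ T. -/
/-! Core definitions: team semantics for dependence logic over a relational vocabulary. -/

/-- A structure for a relational vocabulary: `σ` is the type of relation symbols,
`ar` gives their arities, `A` is the universe. -/
structure DepStr (σ : Type) (ar : σ → ℕ) (A : Type) where
  rel : ∀ r : σ, (Fin (ar r) → A) → Prop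

/-- Formulas of dependence logic (in negation normal form), with free variables
of type `V`; quantifiers extend the variable type by one fresh variable (`Option`). -/
inductive DepFormula (σ : Type) (ar : σ → ℕ) : Type → Type 1 where
  | rel {V : Type} (r : σ) (ts : Fin (ar r) → V) : DepFormula σ ar V
  | nrel {V : Type} (r : σ) (ts : Fin (ar r) → V) : DepFormula σ ar V
  | eq {V : Type} (x y : V) : DepFormula σ ar V
  | neq {V : Type} (x y : V) : DepFormula σ ar V
  | dep {V : Type} (m : ℕ) (ys : Fin m → V) (z : V) : DepFormula σ ar V
  | and {V : Type} (φ ψ : DepFormula σ ar V) : DepFormula σ ar V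
  | or {V : Type} (φ ψ : DepFormula σ ar V) : DepFormula σ ar V
  | all {V : Type} (φ : DepFormula σ ar (Option V)) : DepFormula σ ar V
  | ex {V : Type} (φ : DepFormula σ ar (Option V)) : DepFormula σ ar V

/-- Team semantics: `DepSat M V φ T` says that the team `T` (a set of assignments
`V → A`) satisfies `φ` in the structure `M`. -/
def DepSat {σ : Type} {ar : σ → ℕ} {A : Type} (M : DepStr σ ar A) :
    (V : Type) → DepFormula σ ar V → Set (V → A) → Prop
  | _, .rel r ts, T => ∀ s ∈ T, M.rel r fun i => s (ts i)
  | _, .nrel r ts, T => ∀ s ∈ T, ¬ M.rel r fun i => s (ts i)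
  | _, .eq x y, T => ∀ s ∈ T, s x = s y
  | _, .neq x y, T => ∀ s ∈ T, s x ≠ s y
  | _, .dep _ ys z, T => ∀ s₁ ∈ T, ∀ s₂ ∈ T, (∀ i, s₁ (ys i) = s₂ (ys i)) → s₁ z = s₂ z
  | V, .and φ ψ, T => DepSat M V φ T ∧ DepSat M V ψ T
  | V, .or φ ψ, T => ∃ T₁ T₂, T = T₁ ∪ T₂ ∧ DepSat M V φ T₁ ∧ DepSat M V ψ T₂
  | V, .all φ, T => DepSat M (Option V) φ {s | (fun v => s (some v)) ∈ T}
  | V, .ex φ, T => ∃ f : (V → A) → A,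
      DepSat M (Option V) φ {s | ∃ t ∈ T, s = fun o => Option.elim o (f t) t}

/-- The `∃`-free (universal) fragment `∀D`. -/
def DepFormula.noEx {σ : Type} {ar : σ → ℕ} : (V : Type) → DepFormula σ ar V → Prop
  | _, .ex _ => False
  | V, .all φ => DepFormula.noEx (Option V) φ
  | V, .and φ ψ => DepFormula.noEx V φ ∧ DepFormula.noEx V ψ
  | V, .or φ ψ => DepFormula.noEx V φ ∧ DepFormula.noEx V ψ
  | _, _ => True

/-- The quantifier-free fragment `DQF`. -/
def DepFormula.isQF {σ : Type} {ar : σ → ℕ} : (V : Type) → DepFormula σ ar V → Prop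
  | _, .ex _ => False
  | _, .all _ => False
  | V, .and φ ψ => DepFormula.isQF V φ ∧ DepFormula.isQF V ψ
  | V, .or φ ψ => DepFormula.isQF V φ ∧ DepFormula.isQF V ψ
  | _, _ => True

/-- The dependence-atom-free (first-order) fragment. -/
def DepFormula.noDep {σ : Type} {ar : σ → ℕ} : (V : Type) → DepFormula σ ar V → Prop
  | _, .dep _ _ _ => False
  | V, .and φ ψ => DepFormula.noDep V φ ∧ DepFormula.noDep V ψ
  | V, .or φ ψ => DepFormula.noDep V φ ∧ DepFormula.noDep V ψ
  | V, .all φ => DepFormula.noDep (Option V) φ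
  | V, .ex φ => DepFormula.noDep (Option V) φ
  | _, _ => True

/-- Induced substructure on a subset `B` of the universe (relational vocabulary). -/
def DepStr.sub {σ : Type} {ar : σ → ℕ} {A : Type} (M : DepStr σ ar A) (B : Set A) :
    DepStr σ ar B :=
  ⟨fun r v => M.rel r fun i => (v i : A)⟩

/-- Restriction `T ↾ B` of a team to assignments taking values in `B`. -/
def teamRestrict {V A : Type} (T : Set (V → A)) (B : Set A) : Set (V → B) :=
  {t | (fun v => (t v : A)) ∈ T}


/-- First-order formulas over a relational vocabulary. -/
inductive FOForm (σ : Type) (ar : σ → ℕ) : Type → Type 1 where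
  | rel {V : Type} (r : σ) (ts : Fin (ar r) → V) : FOForm σ ar V
  | eq {V : Type} (x y : V) : FOForm σ ar V
  | not {V : Type} (φ : FOForm σ ar V) : FOForm σ ar V
  | and {V : Type} (φ ψ : FOForm σ ar V) : FOForm σ ar V
  | or {V : Type} (φ ψ : FOForm σ ar V) : FOForm σ ar V
  | all {V : Type} (φ : FOForm σ ar (Option V)) : FOForm σ ar V
  | ex {V : Type} (φ : FOForm σ ar (Option V)) : FOForm σ ar V

/-- Tarskian satisfaction of a first-order formula by a single assignment. -/
def FOSat {σ : Type} {ar : σ → ℕ} {A : Type} (M : DepStr σ ar A) :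
    (V : Type) → FOForm σ ar V → (V → A) → Prop
  | _, .rel r ts, s => M.rel r fun i => s (ts i)
  | _, .eq x y, s => s x = s y
  | V, .not φ, s => ¬ FOSat M V φ s
  | V, .and φ ψ, s => FOSat M V φ s ∧ FOSat M V ψ s
  | V, .or φ ψ, s => FOSat M V φ s ∨ FOSat M V ψ s
  | V, .all φ, s => ∀ a : A, FOSat M (Option V) φ (fun o => Option.elim o a s)
  | V, .ex φ, s => ∃ a : A, FOSat M (Option V) φ (fun o => Option.elim o a s)

/-- A first-order sentence (no free variables) is true in `M`. -/
def FOTrue {σ : Type} {ar : σ → ℕ} {A : Type} (M : DepStr σ ar A)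
    (φ : FOForm σ ar Empty) : Prop :=
  FOSat M Empty φ (fun e => e.elim)

/-- Quantifier-free first-order formulas. -/
def FOForm.isQF {σ : Type} {ar : σ → ℕ} : (V : Type) → FOForm σ ar V → Prop
  | _, .all _ => False
  | _, .ex _ => False
  | V, .not φ => FOForm.isQF V φ
  | V, .and φ ψ => FOForm.isQF V φ ∧ FOForm.isQF V ψ
  | V, .or φ ψ => FOForm.isQF V φ ∧ FOForm.isQF V ψ
  | _, _ => True

/-- Universal first-order formulas: a block of `∀` followed by a quantifier-free formula. -/
inductive FOForm.IsUniversal {σ : Type} {ar : σ → ℕ} : {V : Type} → FOForm σ ar V → Prop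
  | of_qf {V : Type} (φ : FOForm σ ar V) : FOForm.isQF V φ → FOForm.IsUniversal φ
  | all {V : Type} (φ : FOForm σ ar (Option V)) :
      FOForm.IsUniversal φ → FOForm.IsUniversal (.all φ)

/-- `OptIter l V` adds `l` fresh variables to the variable type `V`. -/
def OptIter : ℕ → Type → Type
  | 0, V => V
  | l+1, V => Option (OptIter l V)

/-- The embedding of the old variables into `OptIter l V`. -/
def optEmbed : (l : ℕ) → {V : Type} → V → OptIter l V
  | 0, _, v => v
  | l+1, _, v => some (optEmbed l v)

/-- Prefix a first-order formula with `l` universal quantifiers. -/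
def FOForm.allIter {σ : Type} {ar : σ → ℕ} :
    (l : ℕ) → {V : Type} → FOForm σ ar (OptIter l V) → FOForm σ ar V
  | 0, _, φ => φ
  | l+1, _, φ => FOForm.allIter l (.all φ)

/-- Prefix a dependence formula with `l` universal quantifiers. -/
def DepFormula.allIter {σ : Type} {ar : σ → ℕ} :
    (l : ℕ) → {V : Type} → DepFormula σ ar (OptIter l V) → DepFormula σ ar V
  | 0, _, φ => φ
  | l+1, _, φ => DepFormula.allIter l (.all φ)

/-- The iterated duplicate team `T⟨y⃗ ↦ A⟩`: all extensions of members of `T`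
to the `l` new variables. -/
def dupIter {A : Type} (l : ℕ) {V : Type} (T : Set (V → A)) : Set (OptIter l V → A) :=
  {s | (fun v => s (optEmbed l v)) ∈ T}

/-- The vocabulary `τ ∪ {R}` with `R` a fresh `n`-ary relation symbol. -/
def exAr {σ : Type} (ar : σ → ℕ) (n : ℕ) : σ ⊕ Unit → ℕ :=
  Sum.elim ar fun _ => n

/-- The expansion `(A, Rel(T))` of a structure by a team, interpreting
the fresh symbol `R` as the `n`-ary relation determined by the team `T`. -/
def expandR {σ : Type} {ar : σ → ℕ} {A : Type} {n : ℕ}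
    (M : DepStr σ ar A) (T : Set (Fin n → A)) : DepStr (σ ⊕ Unit) (exAr ar n) A :=
  ⟨fun r => match r with
    | .inl r => M.rel r
    | .inr _ => fun v => v ∈ T⟩

/-- `ψ` rewrites the dependence formula `φ(x₁,…,xₙ)`:  `A ⊨_T φ  ↔  (A, Rel(T)) ⊨ ψ`. -/
def Rewrites {σ : Type} {ar : σ → ℕ} {n : ℕ}
    (ψ : FOForm (σ ⊕ Unit) (exAr ar n) Empty) (φ : DepFormula σ ar (Fin n)) : Prop :=
  ∀ (A : Type) [Nonempty A] (M : DepStr σ ar A) (T : Set (Fin n → A)),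
    DepSat M (Fin n) φ T ↔ FOTrue (expandR M T) ψ

/-- `φ` is first-order rewritable. -/
def FORewritable {σ : Type} {ar : σ → ℕ} {n : ℕ} (φ : DepFormula σ ar (Fin n)) : Prop :=
  ∃ ψ : FOForm (σ ⊕ Unit) (exAr ar n) Empty, Rewrites ψ φ

/-- `φ` is rewritable to a universal first-order sentence. -/
def UnivRewritable {σ : Type} {ar : σ → ℕ} {n : ℕ} (φ : DepFormula σ ar (Fin n)) : Prop :=
  ∃ ψ : FOForm (σ ⊕ Unit) (exAr ar n) Empty, ψ.IsUniversal ∧ Rewrites ψ φ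

/-- `φ` is `k`-coherent: a team satisfies `φ` iff all its subteams with at
most `k` elements do. -/
def KCoherent {σ : Type} {ar : σ → ℕ} {V : Type} (k : ℕ) (φ : DepFormula σ ar V) : Prop :=
  ∀ (A : Type) [Nonempty A] (M : DepStr σ ar A) (T : Set (V → A)),
    DepSat M V φ T ↔ ∀ S ⊆ T, S.Finite → S.ncard ≤ k → DepSat M V φ S

/-- `φ` is coherent: `k`-coherent for some `k ≥ 1`. -/
def Coherent {σ : Type} {ar : σ → ℕ} {V : Type} (φ : DepFormula σ ar V) : Prop :=
  ∃ k : ℕ, 1 ≤ k ∧ KCoherent k φ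

/-- `φ` is `k`-coherent in the finite. -/
def KCoherentFin {σ : Type} {ar : σ → ℕ} {V : Type} (k : ℕ) (φ : DepFormula σ ar V) : Prop :=
  ∀ (A : Type) [Nonempty A] [Finite A] (M : DepStr σ ar A) (T : Set (V → A)),
    DepSat M V φ T ↔ ∀ S ⊆ T, S.Finite → S.ncard ≤ k → DepSat M V φ S

/-- Strong `k`-coherence of `∀y₁…∀y_l β` (with `β` quantifier-free): a team `T`
satisfies `∀y⃗ β` iff every at-most-`k`-element subteam of the duplicated team
`T⟨y⃗ ↦ A⟩` satisfies `β`. -/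
def StronglyKCoherent {σ : Type} {ar : σ → ℕ} (k : ℕ) (n l : ℕ)
    (β : DepFormula σ ar (OptIter l (Fin n))) : Prop :=
  ∀ (A : Type) [Nonempty A] (M : DepStr σ ar A) (T : Set (Fin n → A)),
    DepSat M (Fin n) (DepFormula.allIter l β) T ↔
      ∀ S ⊆ dupIter l T, S.Finite → S.ncard ≤ k → DepSat M (OptIter l (Fin n)) β S

/-- Strong `k`-coherence in the finite. -/
def StronglyKCoherentFin {σ : Type} {ar : σ → ℕ} (k : ℕ) (n l : ℕ)
    (β : DepFormula σ ar (OptIter l (Fin n))) : Prop :=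
  ∀ (A : Type) [Nonempty A] [Finite A] (M : DepStr σ ar A) (T : Set (Fin n → A)),
    DepSat M (Fin n) (DepFormula.allIter l β) T ↔
      ∀ S ⊆ dupIter l T, S.Finite → S.ncard ≤ k → DepSat M (OptIter l (Fin n)) β S

/-- Downward closure for the universal fragment. -/
theorem depSat_mono {σ : Type} {ar : σ → ℕ} {A : Type} (M : DepStr σ ar A) {V : Type}
    (φ : DepFormula σ ar V) (hφ : DepFormula.noEx V φ) {T S : Set (V → A)}
    (h : DepSat M V φ T) (hS : S ⊆ T) : DepSat M V φ S := by
  induction φ with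
  | rel r ts => exact fun s hs => h s (hS hs)
  | nrel r ts => exact fun s hs => h s (hS hs)
  | eq x y => exact fun s hs => h s (hS hs)
  | neq x y => exact fun s hs => h s (hS hs)
  | dep m ys z => exact fun s hs t ht => h s (hS hs) t (hS ht)
  | and φ ψ ih1 ih2 => exact ⟨ih1 hφ.1 h.1 hS, ih2 hφ.2 h.2 hS⟩
  | or φ ψ ih1 ih2 =>
    obtain ⟨T₁, T₂, hT, h1, h2⟩ := h
    refine ⟨S ∩ T₁, S ∩ T₂, ?_, ih1 hφ.1 h1 Set.inter_subset_right,
      ih2 hφ.2 h2 Set.inter_subset_right⟩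
    rw [← Set.inter_union_distrib_left, ← hT]
    exact (Set.inter_eq_left.mpr hS).symm
  | all φ ih => exact ih hφ h (fun s hs => hS hs)
  | ex φ ih => exact hφ.elim

/-- If all finite subteams satisfy a universal formula, so does the team. -/
theorem depSat_of_finite {σ : Type} {ar : σ → ℕ} {A : Type} (M : DepStr σ ar A) {V : Type}
    (φ : DepFormula σ ar V) (hφ : DepFormula.noEx V φ) {T : Set (V → A)}
    (h : ∀ S ⊆ T, S.Finite → DepSat M V φ S) : DepSat M V φ T := by
  induction φ with
  | rel r ts =>
    exact fun s hs => h {s} (Set.singleton_subset_iff.mpr hs) (Set.finite_singleton s) s rfl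
  | nrel r ts =>
    exact fun s hs => h {s} (Set.singleton_subset_iff.mpr hs) (Set.finite_singleton s) s rfl
  | eq x y =>
    exact fun s hs => h {s} (Set.singleton_subset_iff.mpr hs) (Set.finite_singleton s) s rfl
  | neq x y =>
    exact fun s hs => h {s} (Set.singleton_subset_iff.mpr hs) (Set.finite_singleton s) s rfl
  | dep m ys z =>
    exact fun s hs t ht => h {s, t} (Set.pair_subset hs ht) (Set.toFinite _)
      s (Or.inl rfl) t (Or.inr rfl)
  | and φ ψ ih1 ih2 =>
    exact ⟨ih1 hφ.1 fun S hS hf => (h S hS hf).1, ih2 hφ.2 fun S hS hf => (h S hS hf).2⟩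
  | @or V φ ψ ih1 ih2 =>
    classical
    have key : ∀ F : Finset (V → A), ∃ T₁ T₂ : Set (V → A), (↑F ∩ T) = T₁ ∪ T₂ ∧
        DepSat M V φ T₁ ∧ DepSat M V ψ T₂ := fun F =>
      h (↑F ∩ T) Set.inter_subset_right (F.finite_toSet.inter_of_left T)
    choose P Q hPQ hP hQ using key
    let U : Ultrafilter (Finset (V → A)) := Ultrafilter.of Filter.atTop
    have hU : (U : Filter (Finset (V → A))) ≤ Filter.atTop := Ultrafilter.of_le _
    refine ⟨{s | s ∈ T ∧ ∀ᶠ F in (U : Filter (Finset (V → A))), s ∈ P F},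
      {s | s ∈ T ∧ ∀ᶠ F in (U : Filter (Finset (V → A))), s ∈ Q F}, ?_,
      ih1 hφ.1 ?_, ih2 hφ.2 ?_⟩
    · ext s
      constructor
      · intro hs
        have h1 : ∀ᶠ F in (U : Filter (Finset (V → A))), s ∈ P F ∨ s ∈ Q F := by
          refine ((Filter.eventually_ge_atTop ({s} : Finset (V → A))).filter_mono hU).mono ?_
          intro F hF
          have : s ∈ (↑F ∩ T : Set (V → A)) :=
            ⟨Finset.mem_coe.mpr (hF (Finset.mem_singleton_self s)), hs⟩
          rw [hPQ F] at this
          exact this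
        rcases Ultrafilter.eventually_or.mp h1 with h2 | h2
        · exact Or.inl ⟨hs, h2⟩
        · exact Or.inr ⟨hs, h2⟩
      · rintro (hs | hs)
        · exact hs.1
        · exact hs.1
    · intro S hS hf
      have h1 : ∀ᶠ F in (U : Filter (Finset (V → A))), ∀ s ∈ S, s ∈ P F :=
        (Filter.eventually_all_finite hf).mpr fun s hs => (hS hs).2
      obtain ⟨F, hF⟩ := h1.exists
      exact depSat_mono M φ hφ.1 (hP F) hF
    · intro S hS hf
      have h1 : ∀ᶠ F in (U : Filter (Finset (V → A))), ∀ s ∈ S, s ∈ Q F :=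
        (Filter.eventually_all_finite hf).mpr fun s hs => (hS hs).2
      obtain ⟨F, hF⟩ := h1.exists
      exact depSat_mono M ψ hφ.2 (hQ F) hF
  | all φ ih =>
    refine ih hφ fun S hS hf => ?_
    have h1 := h (Set.image (fun s v => s (some v)) S) (by rintro _ ⟨s, hs, rfl⟩; exact hS hs)
      (hf.image _)
    exact depSat_mono M φ hφ h1 fun s hs => ⟨s, hs, rfl⟩
  | ex φ ih => exact hφ.elim

/-- Every `∃`-free dependence formula `φ(x₁,…,xₙ)` is `ω`-coherent:
a team satisfies `φ` iff all its finite subteams do. -/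
theorem stmt10 {σ : Type} {ar : σ → ℕ} {n : ℕ}
    (φ : DepFormula σ ar (Fin n)) (hφ : DepFormula.noEx (Fin n) φ)
    (A : Type) [Nonempty A] (M : DepStr σ ar A) (T : Set (Fin n → A)) :
    DepSat M (Fin n) φ T ↔ ∀ S ⊆ T, S.Finite → DepSat M (Fin n) φ S := by
  exact ⟨fun h S hS _ => depSat_mono M φ hφ h hS, depSat_of_finite M φ hφ⟩
end

section
/- The propositional dependence logic formula dep(p,q) ∨ dep(p,r) is not 3-coherent: every propositional team over domain {p,q,r} with at most 3 elements satisfies it, but the 4-element team whose assignments give (p,q,r) the value tuples (0,0,0), (0,0,1), (0,1,0), (0,1,1) does not satisfy it. -/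
/-! Propositional dependence logic with team semantics. -/

/-- Formulas of propositional dependence logic over propositional variables `P`. -/
inductive PDL (P : Type) : Type where
  | var (p : P) : PDL P
  | nvar (p : P) : PDL P
  | dep (m : ℕ) (ps : Fin m → P) (q : P) : PDL P
  | and (φ ψ : PDL P) : PDL P
  | or (φ ψ : PDL P) : PDL P

/-- Team semantics for propositional dependence logic: a propositional team is a
set of assignments `P → Bool`. -/
def PSat {P : Type} : Set (P → Bool) → PDL P → Prop
  | T, .var p => ∀ s ∈ T, s p = true
  | T, .nvar p => ∀ s ∈ T, s p = false
  | T, .dep _ ps q => ∀ s₁ ∈ T, ∀ s₂ ∈ T, (∀ i, s₁ (ps i) = s₂ (ps i)) → s₁ q = s₂ q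
  | T, .and φ ψ => PSat T φ ∧ PSat T ψ
  | T, .or φ ψ => ∃ T₁ T₂, T = T₁ ∪ T₂ ∧ PSat T₁ φ ∧ PSat T₂ ψ

/-- `φ` is `k`-coherent: a propositional team satisfies `φ` iff all its subteams
with at most `k` elements do. -/
def PKCoherent {P : Type} (k : ℕ) (φ : PDL P) : Prop :=
  ∀ T : Set (P → Bool), PSat T φ ↔ ∀ S ⊆ T, S.Finite → S.ncard ≤ k → PSat S φ

/-- The formula `dep(p,q) ∨ dep(p,r)` over variables `p = 0`, `q = 1`, `r = 2`. -/
def phi15 : PDL (Fin 3) :=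
  .or (.dep 1 (fun _ => 0) 1) (.dep 1 (fun _ => 0) 2)

/-- The 4-element team assigning `(p,q,r)` the tuples `(0,0,0), (0,0,1), (0,1,0), (0,1,1)`. -/
def team15 : Set (Fin 3 → Bool) :=
  {![false, false, false], ![false, false, true], ![false, true, false], ![false, true, true]}

theorem aux_split (T : Set (Fin 3 → Bool)) (a b c : Fin 3 → Bool) (h : T ⊆ {a, b, c})
    (hab : a 1 = b 1) : PSat T phi15 := by
  refine ⟨T ∩ {a, b}, T ∩ {c}, ?_, ?_, ?_⟩
  · ext x
    have := @h x
    simp only [Set.mem_insert_iff, Set.mem_singleton_iff, Set.mem_union, Set.mem_inter_iff] at *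
    tauto
  · rintro x ⟨-, hx⟩ y ⟨-, hy⟩ -
    rcases hx with rfl | rfl <;> rcases hy with rfl | rfl <;> simp [hab]
  · rintro x ⟨-, hx⟩ y ⟨-, hy⟩ -
    rw [Set.mem_singleton_iff.1 hx, Set.mem_singleton_iff.1 hy]

theorem aux_small (T : Set (Fin 3 → Bool)) (hT : T.Finite) (hc : T.ncard ≤ 3) :
    PSat T phi15 := by
  lift T to Finset (Fin 3 → Bool) using hT
  rw [Set.ncard_coe_finset] at hc
  obtain ⟨U, hTU, hU⟩ := Finset.exists_superset_card_eq hc (by simp)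
  obtain ⟨a, b, c, -, -, -, rfl⟩ := Finset.card_eq_three.1 hU
  have h : ∀ x ∈ T, x = a ∨ x = b ∨ x = c := fun x hx => by simpa using hTU hx
  have key : a 1 = b 1 ∨ a 1 = c 1 ∨ b 1 = c 1 := by
    cases a 1 <;> cases b 1 <;> cases c 1 <;> simp
  rcases key with k | k | k
  · exact aux_split _ a b c (fun x hx => h x hx) k
  · exact aux_split _ a c b (fun x hx => by have := h x hx; simp; tauto) k
  · exact aux_split _ b c a (fun x hx => by have := h x hx; simp; tauto) k

theorem aux_team : ¬ PSat team15 phi15 := by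
  rintro ⟨A, B, h, hA, hB⟩
  have m : ∀ x ∈ team15, x ∈ A ∨ x ∈ B := fun x hx => by rw [h] at hx; exact hx
  have m1 := m ![false, false, false] (by simp [team15])
  have m2 := m ![false, false, true] (by simp [team15])
  have m3 := m ![false, true, false] (by simp [team15])
  have m4 := m ![false, true, true] (by simp [team15])
  have cA : ∀ r r', ![false, false, r] ∈ A → ![false, true, r'] ∈ A → False := fun r r' h1 h2 => by
    simpa using hA _ h1 _ h2 (fun _ => rfl)
  have cB : ∀ q q', ![false, q, false] ∈ B → ![false, q', true] ∈ B → False := fun r r' h1 h2 => by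
    simpa using hB _ h1 _ h2 (fun _ => rfl)
  rcases m1 with m1 | m1 <;> rcases m2 with m2 | m2 <;> rcases m3 with m3 | m3 <;>
    rcases m4 with m4 | m4 <;>
    first
      | exact cA _ _ m1 m3 | exact cA _ _ m1 m4 | exact cA _ _ m2 m3 | exact cA _ _ m2 m4
      | exact cB _ _ m1 m2 | exact cB _ _ m1 m4 | exact cB _ _ m3 m2 | exact cB _ _ m3 m4

/-- `dep(p,q) ∨ dep(p,r)` is not 3-coherent: every team over
`{p,q,r}` with at most 3 elements satisfies it, but the 4-element team with value
tuples `(0,0,0), (0,0,1), (0,1,0), (0,1,1)` does not. -/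
theorem stmt15 :
    ¬ PKCoherent 3 phi15 ∧
    (∀ T : Set (Fin 3 → Bool), T.Finite → T.ncard ≤ 3 → PSat T phi15) ∧
    ¬ PSat team15 phi15 := by
  exact ⟨fun h => aux_team ((h team15).2 fun S _ hf hc => aux_small S hf hc), aux_small, aux_team⟩
end
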